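/- Let α ≥ 1 be a real number and C > 0 a constant. For every triple of positive integers k, ℓ, r with k ≥ 3 and r ≥ 3, there exists a positive integer N = N(k,ℓ,r,C,α) such that for all integers n_1 ≤ n_2 ≤ ⋯ ≤ n_r with n_1 ≥ N and n_r ≤ C·n_1^α, the complete multipartite graph K_{n_1,…,n_r} satisfies: rx_{k,ℓ}(K_{n_1,…,n_r}) = k if k < r; rx_{k,ℓ}(K_{n_1,…,n_r}) ∈ {k, k+1} if k ≥ r and ℓ ≤ C(r,2)·⌈k/r⌉²/⌊k/r⌋; and rx_{k,ℓ}(K_{n_1,…,n_r}) = k + 1 if k ≥ r and ℓ > C(r,2)·⌈k/r⌉²/⌊k/r⌋, where C(r,2) denotes the binomial coefficient r choose 2. -/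

import Mathlib

open SimpleGraph

/-- `T` is a rainbow `S`-tree in `G` under edge-coloring `c`:
its vertices contain `S`, it is a tree, and `c` is injective on its edges. -/
def IsRainbowSTree {V β : Type*} (G : SimpleGraph V) (c : Sym2 V → β)
    (S : Set V) (T : G.Subgraph) : Prop :=
  S ⊆ T.verts ∧ T.coe.IsTree ∧ Set.InjOn c T.edgeSet

/-- A family of `S`-trees is internally disjoint: pairwise edge-disjoint, and
the vertex sets of two distinct members meet exactly in `S`. -/
def InternallyDisjoint {V : Type*} {G : SimpleGraph V} (S : Set V)
    {ι : Type*} (T : ι → G.Subgraph) : Prop :=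
  ∀ i j, i ≠ j → (T i).edgeSet ∩ (T j).edgeSet = ∅ ∧ (T i).verts ∩ (T j).verts = S

/-- The coloring `c` provides, for every set `S` of `k` vertices,
`ℓ` internally disjoint rainbow `S`-trees. -/
def HasRainbowSTrees {V β : Type*} (G : SimpleGraph V) (c : Sym2 V → β) (k ℓ : ℕ) : Prop :=
  ∀ S : Finset V, S.card = k →
    ∃ T : Fin ℓ → G.Subgraph,
      (∀ i, IsRainbowSTree G c (S : Set V) (T i)) ∧ InternallyDisjoint (S : Set V) T

/-- The `(k,ℓ)`-rainbow index `rx_{k,ℓ}(G)`: the minimum number `t` of colors such that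
some edge-coloring of `G` with `t` colors gives, for every `k`-set `S`,
`ℓ` internally disjoint rainbow `S`-trees. -/
noncomputable def rainbowIndex {V : Type*} (G : SimpleGraph V) (k ℓ : ℕ) : ℕ :=
  sInf {t : ℕ | ∃ c : Sym2 V → Fin t, HasRainbowSTrees G c k ℓ}


lemma exists_pattern_coloring {E ι : Type*} [Fintype E] [Fintype ι] (t q : ℕ) (ht : 1 ≤ t)
    (e : ι → Fin q × Fin t → E) (he : ∀ x, Function.Injective (e x))
    (h : Fintype.card ι * (t ^ t - 1) ^ q < (t ^ t) ^ q) :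
    ∃ c : E → Fin t, ∀ x, ∃ j, ∀ a, c (e x (j, a)) = a := by
  classical
  by_contra hcon
  push Not at hcon
  let B : ι → Finset (E → Fin t) := fun x =>
    Finset.univ.filter (fun c => ∀ j, ∃ a, c (e x (j, a)) ≠ a)
  have hB : ∀ x, (B x).card * (t ^ t) ^ q ≤ (t ^ t - 1) ^ q * t ^ Fintype.card E := by
    intro x
    let F : (B x) × (Fin q × Fin t → Fin t) →
        (Fin q → {g : Fin t → Fin t // g ≠ id}) × (E → Fin t) := fun p =>
      (fun j => ⟨fun a => p.1.1 (e x (j, a)), by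
        have := (Finset.mem_filter.1 p.1.2).2 j
        obtain ⟨a, ha⟩ := this
        intro hh
        exact ha (congrFun hh a)⟩, Function.extend (e x) p.2 p.1.1)
    have hF : Function.Injective F := by
      rintro ⟨⟨c, hc⟩, g⟩ ⟨⟨c', hc'⟩, g'⟩ hh
      simp only [F, Prod.mk.injEq] at hh
      obtain ⟨h1, h2⟩ := hh
      have h3 : g = g' := by
        funext y
        have := congrFun h2 (e x y)
        rwa [(he x).extend_apply, (he x).extend_apply] at this
      have h4 : c = c' := by
        funext v
        by_cases hv : ∃ y, e x y = v
        · obtain ⟨⟨j, a⟩, rfl⟩ := hv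
          have := congrFun h1 j
          exact congrFun (Subtype.ext_iff.1 this) a
        · have := congrFun h2 v
          rwa [Function.extend_apply' _ _ _ hv, Function.extend_apply' _ _ _ hv] at this
      subst h3 h4
      rfl
    have := Fintype.card_le_of_injective F hF
    have hne : Fintype.card {g : Fin t → Fin t // g ≠ id} = t ^ t - 1 := by
      rw [Fintype.card_subtype_compl]
      simp
    rw [← pow_mul, mul_comm t q]
    simpa [hne, ← pow_mul, mul_comm, Nat.mul_comm] using this
  have hcov : t ^ Fintype.card E ≤ ∑ x, (B x).card := by
    have h1 : (Finset.univ : Finset (E → Fin t)) ⊆ Finset.univ.biUnion B := by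
      intro c _
      obtain ⟨x, hx⟩ := hcon c
      simp only [Finset.mem_biUnion, Finset.mem_univ, true_and]
      exact ⟨x, by simpa [B] using hx⟩
    have h2 := (Finset.card_le_card h1).trans Finset.card_biUnion_le
    simpa using h2
  have h5 : t ^ Fintype.card E * (t ^ t) ^ q ≤
      Fintype.card ι * (t ^ t - 1) ^ q * t ^ Fintype.card E := by
    calc _ ≤ (∑ x, (B x).card) * (t ^ t) ^ q := Nat.mul_le_mul_right _ hcov
      _ = ∑ x, (B x).card * (t ^ t) ^ q := Finset.sum_mul ..
      _ ≤ ∑ x : ι, (t ^ t - 1) ^ q * t ^ Fintype.card E := Finset.sum_le_sum fun x _ => hB x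
      _ = _ := by simp [mul_assoc]
  have hpos : 0 < t ^ Fintype.card E := by positivity
  rw [mul_comm] at h5
  exact absurd (Nat.le_of_mul_le_mul_right h5 hpos) (by omega)

/-- A family of rooted trees given by children and parents. -/
def TreeSys {V : Type*} (G : SimpleGraph V) (S : Finset V) (t : ℕ) {Y : Type*}
    (ch par : Y → Fin t → V) (root : Y → V) : Prop :=
  (∀ y i, G.Adj (ch y i) (par y i)) ∧
  (∀ y i, par y i = root y ∨ ∃ i', par y i = ch y i' ∧ par y i' = root y) ∧
  (∀ y, ∀ s ∈ S, ∃ i, ch y i = s) ∧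
  (∀ y y', y ≠ y' → ∀ v, (v = root y ∨ ∃ i, ch y i = v) →
    (v = root y' ∨ ∃ i, ch y' i = v) → v ∈ S) ∧
  (∀ y i, par y i ∉ S) ∧
  (∀ y i, ch y i ≠ root y) ∧
  (∀ y, Function.Injective (ch y))

lemma TreeSys.inj {V : Type*} {G : SimpleGraph V} {S : Finset V} {t : ℕ} {Y : Type*}
    {ch par : Y → Fin t → V} {root : Y → V} (h : TreeSys G S t ch par root) :
    Function.Injective (fun p : Y × Fin t => s(ch p.1 p.2, par p.1 p.2)) := by
  obtain ⟨hadj, hpar, hS, hdis, hnS, hroot, hinj⟩ := h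
  have hmem : ∀ y i, par y i = root y ∨ ∃ i', ch y i' = par y i := by
    intro y i
    rcases hpar y i with h | ⟨i', h, _⟩
    · exact Or.inl h
    · exact Or.inr ⟨i', h.symm⟩
  rintro ⟨y, i⟩ ⟨y', i'⟩ heq
  simp only [Sym2.eq_iff] at heq
  have hy : y = y' := by
    by_contra hne
    refine hnS y i (hdis y y' hne _ (hmem y i) ?_)
    rcases heq with ⟨_, h2⟩ | ⟨_, h2⟩
    · rw [h2]; exact hmem y' i'
    · exact Or.inr ⟨i', h2.symm⟩
  subst hy
  rcases heq with ⟨h1, _⟩ | ⟨h1, h2⟩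
  · rw [hinj y h1]
  · exfalso
    rcases hpar y i' with h | ⟨i'', h3, h4⟩
    · exact hroot y i (h1.trans h)
    · have : i = i'' := hinj y (h1.trans h3)
      subst this
      exact hroot y i' (h2.symm.trans h4)

lemma TreeSys.trees {V : Type*} {G : SimpleGraph V} {S : Finset V} {t : ℕ} {Y : Type*}
    {ch par : Y → Fin t → V} {root : Y → V} (h : TreeSys G S t ch par root)
    (c : Sym2 V → Fin t) {ι : Type*} (f : ι → Y) (hf : Function.Injective f)
    (hc : ∀ a i, c s(ch (f a) i, par (f a) i) = i) :
    ∃ T : ι → G.Subgraph,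
      (∀ i, IsRainbowSTree G c (S : Set V) (T i)) ∧ InternallyDisjoint (S : Set V) T := by
  classical
  obtain ⟨hadj, hpar, hS, hdis, hnS, hroot, hinj⟩ := h
  have hmem : ∀ y i, par y i = root y ∨ ∃ i', ch y i' = par y i := by
    intro y i
    rcases hpar y i with h | ⟨i', h, _⟩
    · exact Or.inl h
    · exact Or.inr ⟨i', h.symm⟩
  let T : ι → G.Subgraph := fun a =>
    { verts := {v | v = root (f a) ∨ ∃ i, ch (f a) i = v}
      Adj := fun x y => ∃ i, (x = ch (f a) i ∧ y = par (f a) i) ∨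
        (y = ch (f a) i ∧ x = par (f a) i)
      adj_sub := by
        rintro x y ⟨i, ⟨rfl, rfl⟩ | ⟨rfl, rfl⟩⟩
        · exact hadj _ _
        · exact (hadj _ _).symm
      edge_vert := by
        rintro x y ⟨i, ⟨rfl, rfl⟩ | ⟨rfl, rfl⟩⟩
        · exact Or.inr ⟨i, rfl⟩
        · exact hmem _ _
      symm := by
        refine ⟨?_⟩
        rintro x y ⟨i, h⟩
        exact ⟨i, h.symm⟩ }
  have hedge : ∀ a, (T a).edgeSet = Set.range (fun i => s(ch (f a) i, par (f a) i)) := by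
    intro a
    ext e
    induction e with
    | _ x y =>
      rw [Subgraph.mem_edgeSet]
      simp only [T, Set.mem_range, Sym2.eq_iff]
      constructor
      · rintro ⟨i, ⟨rfl, rfl⟩ | ⟨rfl, rfl⟩⟩
        · exact ⟨i, Or.inl ⟨rfl, rfl⟩⟩
        · exact ⟨i, Or.inr ⟨rfl, rfl⟩⟩
      · rintro ⟨i, ⟨rfl, rfl⟩ | ⟨rfl, rfl⟩⟩
        · exact ⟨i, Or.inl ⟨rfl, rfl⟩⟩
        · exact ⟨i, Or.inr ⟨rfl, rfl⟩⟩
  have hverts : ∀ a, (T a).verts = Set.range (fun o : Option (Fin t) =>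
      o.elim (root (f a)) (ch (f a))) := by
    intro a
    ext v
    simp only [T, Set.mem_ofPred_eq, Set.mem_range, Option.exists, Option.elim]
    simp only [eq_comm]
  refine ⟨T, fun a => ⟨?_, ?_, ?_⟩, ?_⟩
  · intro s hs
    exact Or.inr (hS (f a) s hs)
  · have hfin : Finite (T a).verts := by
      rw [hverts]; exact Set.finite_range _
    have hfe : Finite (T a).edgeSet := by
      rw [hedge]; exact Set.finite_range _
    rw [isTree_iff_connected_and_card]
    have hconn : (T a).coe.Connected := by
      have hr : root (f a) ∈ (T a).verts := Or.inl rfl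
      have hcm : ∀ i, ch (f a) i ∈ (T a).verts := fun i => Or.inr ⟨i, rfl⟩
      have h1 : ∀ i, par (f a) i = root (f a) →
          (T a).coe.Reachable ⟨ch (f a) i, hcm i⟩ ⟨root (f a), hr⟩ := by
        intro i hi
        apply SimpleGraph.Adj.reachable
        rw [Subgraph.coe_adj]
        exact ⟨i, Or.inl ⟨rfl, hi.symm⟩⟩
      have h2 : ∀ i, (T a).coe.Reachable ⟨ch (f a) i, hcm i⟩ ⟨root (f a), hr⟩ := by
        intro i
        rcases hpar (f a) i with h | ⟨i', h, h'⟩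
        · exact h1 i h
        · refine SimpleGraph.Reachable.trans (SimpleGraph.Adj.reachable ?_) (h1 i' h')
          rw [Subgraph.coe_adj]
          exact ⟨i, Or.inl ⟨rfl, h.symm⟩⟩
      have h3 : ∀ v : (T a).verts, (T a).coe.Reachable v ⟨root (f a), hr⟩ := by
        rintro ⟨v, rfl | ⟨i, rfl⟩⟩
        · exact SimpleGraph.Reachable.refl _
        · exact h2 i
      exact { preconnected := fun u v => (h3 u).trans (h3 v).symm
              nonempty := ⟨⟨_, hr⟩⟩ }
    refine ⟨hconn, le_antisymm ?_ hconn.card_vert_le_card_edgeSet_add_one⟩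
    have hV : Nat.card (T a).verts = t + 1 := by
      rw [hverts, Nat.card_range_of_injective]
      · simp
      · rintro (_ | i) (_ | j) hij
        · rfl
        · exact absurd hij.symm (hroot (f a) j)
        · exact absurd hij (hroot (f a) i)
        · rw [hinj _ hij]
    have hE : Nat.card (T a).coe.edgeSet ≤ t := by
      have e1 : Nat.card (T a).coe.edgeSet ≤ Nat.card (T a).edgeSet := by
        refine Nat.card_le_card_of_injective
          (fun e => (⟨Sym2.map Subtype.val e.1, ?_⟩ : (T a).edgeSet)) ?_
        · obtain ⟨e, he⟩ := e
          induction e with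
          | _ x y => simpa using he
        · rintro ⟨e, he⟩ ⟨e', he'⟩ hh
          have := Sym2.map.injective Subtype.val_injective (Subtype.ext_iff.1 hh)
          exact Subtype.ext this
      refine e1.trans ?_
      rw [hedge]
      have := Finite.card_range_le (fun i => s(ch (f a) i, par (f a) i))
      simpa using this
    omega
  · rw [hedge]
    rintro _ ⟨i, rfl⟩ _ ⟨j, rfl⟩ hij
    simp only [hc] at hij
    rw [hij]
  · intro a b hab
    have hne : f a ≠ f b := fun h => hab (hf h)
    have hv : (T a).verts ∩ (T b).verts = (S : Set V) := by
      ext v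
      constructor
      · rintro ⟨h1, h2⟩
        exact hdis _ _ hne v h1 h2
      · intro hv
        exact ⟨Or.inr (hS _ v hv), Or.inr (hS _ v hv)⟩
    refine ⟨?_, hv⟩
    rw [Set.eq_empty_iff_forall_notMem]
    rintro e ⟨h1, h2⟩
    rw [hedge] at h1
    obtain ⟨i, rfl⟩ := h1
    rw [Subgraph.mem_edgeSet] at h2
    have h3 := (T b).edge_vert h2.symm
    exact hnS _ _ (hdis _ _ hne _ (hmem (f a) i) h3)

lemma hasRainbow_of_treeSys {V : Type*} [Fintype V] (G : SimpleGraph V) (k ℓ t q : ℕ)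
    (ht : 1 ≤ t)
    (hsys : ∀ S : Finset V, S.card = k → ∃ (ch par : Fin ℓ × Fin q → Fin t → V)
      (root : Fin ℓ × Fin q → V), TreeSys G S t ch par root)
    (h : Fintype.card V ^ k * ℓ * (t ^ t - 1) ^ q < (t ^ t) ^ q) :
    ∃ c : Sym2 V → Fin t, HasRainbowSTrees G c k ℓ := by
  classical
  choose ch par root hts using hsys
  let ι := {S : Finset V // S.card = k} × Fin ℓ
  let e : ι → Fin q × Fin t → Sym2 V := fun x p =>
    s(ch x.1.1 x.1.2 (x.2, p.1) p.2, par x.1.1 x.1.2 (x.2, p.1) p.2)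
  have hcard : Fintype.card ι ≤ Fintype.card V ^ k * ℓ := by
    simp only [ι, Fintype.card_prod, Fintype.card_fin, Fintype.card_finset_len]
    exact Nat.mul_le_mul_right _ (Nat.choose_le_pow _ _)
  obtain ⟨c, hc⟩ := exists_pattern_coloring t q ht e (by
    rintro x ⟨j, i⟩ ⟨j', i'⟩ hh
    have := (hts x.1.1 x.1.2).inj (a₁ := ((x.2, j), i)) (a₂ := ((x.2, j'), i')) hh
    simp only [Prod.mk.injEq] at this
    simp [this]) (lt_of_le_of_lt (Nat.mul_le_mul_right _ hcard) h)
  refine ⟨c, fun S hS => ?_⟩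
  choose j hj using hc
  exact (hts S hS).trees c (fun a => (a, j (⟨S, hS⟩, a)))
    (fun a b hab => (Prod.mk.inj hab).1) (fun a i => hj (⟨S, hS⟩, a) i)

lemma numeric_bound (α C : ℝ) (hα : 1 ≤ α) (hC : 0 < C) (k ℓ r t : ℕ) (hℓ : 1 ≤ ℓ) (ht : 1 ≤ t) :
    ∃ N : ℕ, ∀ n0 v : ℕ, N ≤ n0 → (v : ℝ) ≤ r * (C * (n0 : ℝ) ^ α) →
      ∃ q, k + ℓ * q ≤ n0 ∧ v ^ k * ℓ * (t ^ t - 1) ^ q < (t ^ t) ^ q := by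
  set m := ⌈α⌉₊ with hm
  set x : ℝ := ((t : ℝ) ^ t - 1) / (t : ℝ) ^ t with hx
  have htt : (1 : ℝ) ≤ (t : ℝ) ^ t := one_le_pow₀ (by exact_mod_cast ht)
  have hx0 : 0 ≤ x := div_nonneg (by linarith) (by linarith)
  have hx1 : x < 1 := by rw [hx, div_lt_one (by linarith)]; linarith
  set K : ℝ := (r * C * (2 * (k + ℓ)) ^ m) ^ k * ℓ with hK
  have htend := (tendsto_pow_const_mul_const_pow_of_lt_one (m * k) hx0 hx1).const_mul K
  rw [mul_zero] at htend
  obtain ⟨Q, hQ⟩ := Filter.eventually_atTop.1 (htend.eventually_lt_const zero_lt_one)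
  refine ⟨k + ℓ * (Q + 1), fun n0 v hn hv => ⟨(n0 - k) / ℓ, ?_, ?_⟩⟩
  · have := Nat.mul_div_le (n0 - k) ℓ
    have : k ≤ n0 := le_trans (Nat.le_add_right _ _) hn
    omega
  set q := (n0 - k) / ℓ with hq
  have hqQ : Q + 1 ≤ q := by
    rw [hq, Nat.le_div_iff_mul_le (by omega), mul_comm]
    omega
  have hn0 : n0 ≤ 2 * (k + ℓ) * q := by
    have h1 : n0 - k < ℓ * (q + 1) := by
      rw [mul_comm]; exact Nat.lt_mul_of_div_lt (Nat.lt_succ_self _) (by omega)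
    have h2 : n0 < k + ℓ * (q + 1) := by omega
    have h3 : 1 ≤ q := by omega
    nlinarith [Nat.mul_le_mul_left k h3, Nat.mul_le_mul_left ℓ h3]
  have hn1 : 1 ≤ n0 := by nlinarith
  have h1 : (n0 : ℝ) ^ α ≤ (2 * (k + ℓ) * q : ℝ) ^ m := by
    have a1 : (n0 : ℝ) ^ α ≤ (n0 : ℝ) ^ (m : ℝ) :=
      Real.rpow_le_rpow_of_exponent_le (by exact_mod_cast hn1) (Nat.le_ceil α)
    rw [Real.rpow_natCast] at a1
    refine a1.trans (pow_le_pow_left₀ (by positivity) (by exact_mod_cast hn0) m)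
  have h2 : (v : ℝ) ^ k * ℓ ≤ K * (q : ℝ) ^ (m * k) := by
    have : (v : ℝ) ≤ r * C * (2 * (k + ℓ)) ^ m * (q : ℝ) ^ m := by
      calc (v : ℝ) ≤ r * (C * (n0 : ℝ) ^ α) := hv
        _ ≤ r * (C * (2 * (k + ℓ) * q : ℝ) ^ m) := by gcongr
        _ = _ := by rw [mul_pow]; ring
    calc (v : ℝ) ^ k * ℓ ≤ (r * C * (2 * (k + ℓ)) ^ m * (q : ℝ) ^ m) ^ k * ℓ := by gcongr
      _ = _ := by rw [hK, mul_pow, pow_mul]; ring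
  have h3 := hQ q (by omega)
  have h4 : (v : ℝ) ^ k * ℓ * x ^ q < 1 := by
    refine lt_of_le_of_lt ?_ h3
    rw [← mul_assoc]
    exact mul_le_mul_of_nonneg_right h2 (by positivity)
  rw [hx, div_pow, ← mul_div_assoc, div_lt_one (by positivity)] at h4
  have h5 : 1 ≤ t ^ t := Nat.one_le_pow _ _ ht
  have : ((v ^ k * ℓ * (t ^ t - 1) ^ q : ℕ) : ℝ) < (((t ^ t) ^ q : ℕ) : ℝ) := by
    push_cast [h5]
    exact h4
  exact_mod_cast this

lemma exists_outside {r : ℕ} (n : Fin r → ℕ) (S : Finset (Σ i, Fin (n i))) (k ℓ q : ℕ)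
    (hS : S.card = k) (i : Fin r) (h : k + ℓ * q ≤ n i) :
    ∃ u : Fin ℓ × Fin q → Σ i, Fin (n i), Function.Injective u ∧ ∀ y, (u y).1 = i ∧ u y ∉ S := by
  classical
  let A : Finset (Fin (n i)) := Finset.univ.filter (fun x => (⟨i, x⟩ : Σ i, Fin (n i)) ∉ S)
  have hA : ℓ * q ≤ A.card := by
    have h1 := Finset.card_filter_add_card_filter_not (s := (Finset.univ : Finset (Fin (n i))))
      (fun x => (⟨i, x⟩ : Σ i, Fin (n i)) ∉ S)
    have h2 : (Finset.univ.filter (fun x : Fin (n i) =>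
        ¬ (⟨i, x⟩ : Σ i, Fin (n i)) ∉ S)).card ≤ S.card := by
      refine Finset.card_le_card_of_injOn (fun x => ⟨i, x⟩) ?_ ?_
      · intro x hx
        simpa using hx
      · intro x _ y _ hxy
        simpa using hxy
    rw [Finset.card_univ, Fintype.card_fin] at h1
    change A.card + _ = _ at h1
    omega
  obtain ⟨g⟩ := Function.Embedding.nonempty_of_card_le (α := Fin ℓ × Fin q) (β := A) (by simpa using hA)
  refine ⟨fun y => ⟨i, (g y).1⟩, ?_, fun y => ⟨rfl, ?_⟩⟩
  · intro y y' h
    simp only [Sigma.mk.injEq, heq_eq_eq, true_and] at h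
    exact g.injective (Subtype.ext h)
  · exact (Finset.mem_filter.1 (g y).2).2

lemma star_sys {r : ℕ} (n : Fin r → ℕ) (k ℓ q : ℕ) (hn : ∀ i, k + ℓ * q ≤ n i) (hkr : k < r)
    (S : Finset (Σ i, Fin (n i))) (hS : S.card = k) :
    ∃ (ch par : Fin ℓ × Fin q → Fin k → Σ i, Fin (n i)) (root : Fin ℓ × Fin q → Σ i, Fin (n i)),
      TreeSys (completeMultipartiteGraph (fun i : Fin r => Fin (n i))) S k ch par root := by
  classical
  obtain ⟨i, hi⟩ : ∃ i : Fin r, ∀ s ∈ S, s.1 ≠ i := by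
    by_contra hcon
    push Not at hcon
    have : (Finset.univ : Finset (Fin r)) ⊆ S.image Sigma.fst := by
      intro i _
      obtain ⟨s, hs, h⟩ := hcon i
      exact Finset.mem_image.2 ⟨s, hs, h⟩
    have := (Finset.card_le_card this).trans Finset.card_image_le
    simp at this
    omega
  obtain ⟨u, hu, huS⟩ := exists_outside n S k ℓ q hS i (hn i)
  let e := (S.equivFinOfCardEq hS).symm
  refine ⟨fun _ j => (e j).1, fun y _ => u y, u, ?_, ?_, ?_, ?_, ?_, ?_, ?_⟩
  · intro y j
    have := hi _ (e j).2
    simpa [(huS y).1] using this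
  · intro y j; exact Or.inl rfl
  · intro y s hs
    exact ⟨e.symm ⟨s, hs⟩, by simp⟩
  · rintro y y' hne v (rfl | ⟨j, rfl⟩) h
    · rcases h with h | ⟨j, h⟩
      · exact absurd (hu h) hne
      · rw [← h]; exact (e j).2
    · exact (e j).2
  · intro y j; exact (huS y).2
  · intro y j h
    have h2 := (e j).2
    simp only at h
    rw [h] at h2
    exact (huS y).2 h2
  · intro y j j' h
    exact e.injective (Subtype.ext h)

lemma dstar_sys {r : ℕ} (n : Fin r → ℕ) (k ℓ q : ℕ) (hn : ∀ i, k + ℓ * q ≤ n i) (hr : 3 ≤ r)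
    (S : Finset (Σ i, Fin (n i))) (hS : S.card = k) :
    ∃ (ch par : Fin ℓ × Fin q → Fin (k + 1) → Σ i, Fin (n i))
      (root : Fin ℓ × Fin q → Σ i, Fin (n i)),
      TreeSys (completeMultipartiteGraph (fun i : Fin r => Fin (n i))) S (k + 1) ch par root := by
  classical
  let i0 : Fin r := ⟨0, by omega⟩
  let i1 : Fin r := ⟨1, by omega⟩
  have hi01 : i0 ≠ i1 := by simp [i0, i1, Fin.ext_iff]
  obtain ⟨u, hu, huS⟩ := exists_outside n S k ℓ q hS i0 (hn i0)
  obtain ⟨w, hw, hwS⟩ := exists_outside n S k ℓ q hS i1 (hn i1)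
  have huw : ∀ y y', w y ≠ u y' := by
    intro y y' h
    have := (hwS y).1
    rw [h, (huS y').1] at this
    exact hi01 this
  let e := (S.equivFinOfCardEq hS).symm
  have heu : ∀ j y, (e j).1 ≠ u y := fun j y h => (huS y).2 (h ▸ (e j).2)
  have hew : ∀ j y, (e j).1 ≠ w y := fun j y h => (hwS y).2 (h ▸ (e j).2)
  let ch : Fin ℓ × Fin q → Fin (k + 1) → Σ i, Fin (n i) := fun y =>
    Fin.snoc (α := fun _ => Σ i, Fin (n i)) (fun j => (e j).1) (w y)
  let par : Fin ℓ × Fin q → Fin (k + 1) → Σ i, Fin (n i) := fun y =>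
    Fin.snoc (α := fun _ => Σ i, Fin (n i)) (fun j => if (e j).1.1 = i0 then w y else u y) (u y)
  have ch1 : ∀ y j, ch y (Fin.castSucc j) = (e j).1 := fun y j => by simp [ch]
  have ch2 : ∀ y, ch y (Fin.last k) = w y := fun y => by simp [ch]
  have par1 : ∀ y j, par y (Fin.castSucc j) = if (e j).1.1 = i0 then w y else u y :=
    fun y j => by simp [par]
  have par2 : ∀ y, par y (Fin.last k) = u y := fun y => by simp [par]
  clear_value ch par
  refine ⟨ch, par, u, ?_, ?_, ?_, ?_, ?_, ?_, ?_⟩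
  · intro y j
    induction j using Fin.lastCases with
    | last =>
      rw [ch2, par2]
      change (w y).1 ≠ (u y).1
      rw [(hwS y).1, (huS y).1]; exact hi01.symm
    | cast j =>
      rw [ch1, par1]
      split_ifs with h
      · change (e j).1.1 ≠ (w y).1
        rw [(hwS y).1, h]; exact hi01
      · change (e j).1.1 ≠ (u y).1
        rw [(huS y).1]; exact h
  · intro y j
    induction j using Fin.lastCases with
    | last => exact Or.inl (par2 y)
    | cast j =>
      rw [par1]
      split_ifs with h
      · exact Or.inr ⟨Fin.last k, (ch2 y).symm, par2 y⟩
      · exact Or.inl rfl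
  · intro y s hs
    exact ⟨Fin.castSucc (e.symm ⟨s, hs⟩), by simp [ch1]⟩
  · have key : ∀ y v, (v = u y ∨ ∃ i, ch y i = v) → v = u y ∨ v = w y ∨ v ∈ S := by
      rintro y v (h | ⟨j, rfl⟩)
      · exact Or.inl h
      · induction j using Fin.lastCases with
        | last => exact Or.inr (Or.inl (ch2 y))
        | cast j => rw [ch1]; exact Or.inr (Or.inr (e j).2)
    intro y y' hne v h h'
    rcases key y v h with h | h | h
    · rcases key y' v h' with h' | h' | h'
      · exact absurd (hu (h.symm.trans h')) hne
      · exact absurd (h'.symm.trans h) (huw _ _)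
      · exact h'
    · rcases key y' v h' with h' | h' | h'
      · exact absurd (h.symm.trans h') (huw _ _)
      · exact absurd (hw (h.symm.trans h')) hne
      · exact h'
    · exact h
  · intro y j
    induction j using Fin.lastCases with
    | last => rw [par2]; exact (huS y).2
    | cast j =>
      rw [par1]
      split_ifs with h
      · exact (hwS y).2
      · exact (huS y).2
  · intro y j
    induction j using Fin.lastCases with
    | last => rw [ch2]; exact huw y y
    | cast j => rw [ch1]; exact heu j y
  · intro y j j' h
    induction j using Fin.lastCases with
    | last =>
      induction j' using Fin.lastCases with
      | last => rfl
      | cast j' => rw [ch1, ch2] at h; exact absurd h.symm (hew j' y)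
    | cast j =>
      induction j' using Fin.lastCases with
      | last => rw [ch1, ch2] at h; exact absurd h (hew j y)
      | cast j' =>
        rw [ch1, ch1] at h
        rw [e.injective (Subtype.ext h)]

lemma rainbow_verts_le {V : Type*} [Finite V] {G : SimpleGraph V} {t : ℕ} {c : Sym2 V → Fin t}
    {S : Set V} {T : G.Subgraph} (h : IsRainbowSTree G c S T) : T.verts.ncard ≤ t + 1 := by
  classical
  obtain ⟨_, hT, hinj⟩ := h
  have h1 := (isTree_iff_connected_and_card.1 hT).2
  have h2 : Nat.card T.coe.edgeSet ≤ Nat.card (Fin t) := by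
    refine Nat.card_le_card_of_injective (fun e => c (Sym2.map Subtype.val e.1)) ?_
    have hm : ∀ e : T.coe.edgeSet, Sym2.map Subtype.val e.1 ∈ T.edgeSet := by
      rintro ⟨e, he⟩
      induction e with
      | _ x y => simpa using he
    intro e e' hh
    exact Subtype.ext (Sym2.map.injective Subtype.val_injective (hinj (hm e) (hm e') hh))
  rw [Nat.card_fin] at h2
  rw [← Nat.card_coe_set_eq]
  omega

lemma rainbow_exists_adj {V β : Type*} {G : SimpleGraph V} {c : Sym2 V → β}
    {S : Finset V} {T : G.Subgraph} (h : IsRainbowSTree G c (S : Set V) T) (hS : 2 ≤ S.card)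
    (v : V) (hv : v ∈ S) : ∃ w, T.Adj v w := by
  obtain ⟨hsub, hT, _⟩ := h
  obtain ⟨a, ha, b, hb, hab⟩ := Finset.one_lt_card.1 hS
  have : Nontrivial T.verts := ⟨⟨a, hsub ha⟩, ⟨b, hsub hb⟩, fun h => hab (Subtype.ext_iff.1 h)⟩
  obtain ⟨w, hw⟩ := hT.connected.preconnected.exists_adj_of_nontrivial ⟨v, hsub hv⟩
  exact ⟨w, hw⟩

lemma lower_one {r : ℕ} (n : Fin r → ℕ) (k ℓ t : ℕ) (hk : 3 ≤ k) (hℓ : 1 ≤ ℓ) (i : Fin r)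
    (hn : k ≤ n i) (c : Sym2 (Σ i, Fin (n i)) → Fin t)
    (h : HasRainbowSTrees (completeMultipartiteGraph (fun i : Fin r => Fin (n i))) c k ℓ) :
    k ≤ t := by
  classical
  by_contra hlt
  obtain ⟨A, -, hA⟩ := Finset.exists_subset_card_eq (s := (Finset.univ : Finset (Fin (n i)))) (n := k)
    (by simpa using hn)
  let S : Finset (Σ i, Fin (n i)) := A.map ⟨fun x => ⟨i, x⟩, fun x y h => by simpa using h⟩
  have hS : S.card = k := by simp [S, hA]
  have hSi : ∀ s ∈ S, s.1 = i := by
    intro s hs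
    simp only [S, Finset.mem_map] at hs
    obtain ⟨x, _, rfl⟩ := hs
    rfl
  obtain ⟨T, hT, _⟩ := h S hS
  have h0 := hT ⟨0, hℓ⟩
  have h1 := rainbow_verts_le h0
  have hV : (S : Set _) = (T ⟨0, hℓ⟩).verts := by
    apply Set.eq_of_subset_of_ncard_le h0.1
    rw [Set.ncard_coe_finset]
    omega
  obtain ⟨s, hs⟩ : S.Nonempty := Finset.card_pos.1 (by omega)
  obtain ⟨w, hw⟩ := rainbow_exists_adj h0 (by omega) s hs
  have hwS : w ∈ S := by
    have := (T ⟨0, hℓ⟩).edge_vert hw.symm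
    rw [← hV] at this
    exact this
  have hadj : s.1 ≠ w.1 := (T ⟨0, hℓ⟩).adj_sub hw
  exact hadj ((hSi s hs).trans (hSi w hwS).symm)

lemma lower_two {r : ℕ} (n : Fin r → ℕ) (k ℓ t M : ℕ) (hk : 3 ≤ k) (hr : 3 ≤ r)
    (hn : ∀ i, k ≤ n i) (htk : t ≤ k) (c : Sym2 (Σ i, Fin (n i)) → Fin t)
    (hM : ∀ i < r, k / r + (if i < k % r then 1 else 0) ≤ M)
    (h : HasRainbowSTrees (completeMultipartiteGraph (fun i : Fin r => Fin (n i))) c k ℓ) :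
    ℓ * (k / r) * 2 ≤ (r * r - r) * (M * M) := by
  classical
  let a : Fin r → ℕ := fun i => k / r + (if i.1 < k % r then 1 else 0)
  have hmod : k % r < r := Nat.mod_lt _ (by omega)
  have hdm := Nat.div_add_mod k r
  have hsum : ∑ i, a i = k := by
    have h1 : ∑ i : Fin r, (if i.1 < k % r then 1 else 0) = k % r := by
      rw [Fin.sum_univ_eq_sum_range (fun i => if i < k % r then 1 else 0), ← Finset.sum_filter]
      have : (Finset.range r).filter (fun i => i < k % r) = Finset.range (k % r) := by
        ext x; simp; omega
      simp [this]
    simp only [a, Finset.sum_add_distrib, h1]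
    simpa using hdm
  have hak : ∀ i, a i ≤ n i := by
    intro i
    have : a i ≤ ∑ i, a i := Finset.single_le_sum (fun _ _ => Nat.zero_le _) (Finset.mem_univ i)
    have := hn i
    omega
  let S : Finset (Σ i, Fin (n i)) :=
    Finset.univ.sigma (fun i => Finset.univ.filter (fun x : Fin (n i) => x.1 < a i))
  have hmemS : ∀ v, v ∈ S ↔ v.2.1 < a v.1 := by
    intro v; simp [S]
  have hS : S.card = k := by
    rw [Finset.card_sigma, ← hsum]
    refine Finset.sum_congr rfl fun i _ => ?_
    rw [Fin.card_filter_val_lt]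
    exact min_eq_right (hak i)
  obtain ⟨T, hT, hdis⟩ := h S hS
  have hcls : ∀ x, ∃ i : Fin r, ∀ v ∈ (T x).verts, v ∉ S → v.1 = i := by
    intro x
    by_cases hx : ∃ v ∈ (T x).verts, v ∉ S
    · obtain ⟨v, hv, hvS⟩ := hx
      refine ⟨v.1, fun v' hv' hvS' => ?_⟩
      by_contra hne
      have hne' : v ≠ v' := fun h => hne (by rw [h])
      have h1 := rainbow_verts_le (hT x)
      have hsub : ((insert v (insert v' S) : Finset _) : Set _) ⊆ (T x).verts := by
        intro z hz
        simp only [Finset.coe_insert, Set.mem_insert_iff] at hz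
        rcases hz with rfl | rfl | hz
        · exact hv
        · exact hv'
        · exact (hT x).1 hz
      have h2 := Set.ncard_le_ncard hsub
      rw [Set.ncard_coe_finset, Finset.card_insert_of_notMem (by simp [hne', hvS]),
        Finset.card_insert_of_notMem hvS'] at h2
      omega
    · push Not at hx
      exact ⟨⟨0, by omega⟩, fun v hv hvS => absurd (hx v hv) hvS⟩
  choose cl hcl using hcls
  have hma : ∀ i (m : Fin (k / r)), m.1 < a i := fun i m => by
    have := m.2
    simp only [a]; omega
  let s : Fin ℓ → Fin (k / r) → Σ i, Fin (n i) := fun x m =>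
    ⟨cl x, ⟨m.1, lt_of_lt_of_le (hma _ m) (hak _)⟩⟩
  have hsS : ∀ x m, s x m ∈ S := fun x m => (hmemS _).2 (hma _ m)
  have hg : ∀ x m, ∃ w, (T x).Adj (s x m) w :=
    fun x m => rainbow_exists_adj (hT x) (by omega) _ (hsS x m)
  choose g hg using hg
  have hgc : ∀ x m, (g x m).1 ≠ cl x := by
    intro x m
    have : (s x m).1 ≠ (g x m).1 := (T x).adj_sub (hg x m)
    exact this.symm
  have hgS : ∀ x m, g x m ∈ S := by
    intro x m
    by_contra hcon
    exact hgc x m (hcl x _ ((T x).edge_vert (hg x m).symm) hcon)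
  let P : Fin ℓ × Fin (k / r) × Bool → (Σ i, Fin (n i)) × (Σ i, Fin (n i)) := fun z =>
    if z.2.2 then (s z.1 z.2.1, g z.1 z.2.1) else (g z.1 z.2.1, s z.1 z.2.1)
  have hPadj : ∀ z, (T z.1).Adj (P z).1 (P z).2 := by
    rintro ⟨x, m, b⟩
    cases b
    · exact (hg x m).symm
    · exact hg x m
  have hPS : ∀ z, (P z).1 ∈ S ∧ (P z).2 ∈ S := by
    rintro ⟨x, m, b⟩
    cases b
    · exact ⟨hgS x m, hsS x m⟩
    · exact ⟨hsS x m, hgS x m⟩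
  have hPinj : Function.Injective P := by
    intro z z' hzz
    have hx : z.1 = z'.1 := by
      by_contra hne
      have h1 := (hdis z.1 z'.1 hne).1
      rw [Set.eq_empty_iff_forall_notMem] at h1
      refine h1 s((P z).1, (P z).2) ⟨hPadj z, ?_⟩
      rw [hzz]
      exact hPadj z'
    obtain ⟨x, m, b⟩ := z
    obtain ⟨x', m', b'⟩ := z'
    simp only at hx
    subst hx
    have hsm : s x m = s x m' → m = m' := by
      intro h
      simp only [s, Sigma.mk.injEq, heq_eq_eq, true_and, Fin.mk.injEq] at h
      exact Fin.ext h
    cases b <;> cases b' <;> simp only [P, if_true, Bool.false_eq_true, if_false, Prod.mk.injEq] at hzz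
    · rw [hsm hzz.2]
    · exact absurd (congrArg Sigma.fst hzz.1) (hgc x m)
    · exact absurd (congrArg Sigma.fst hzz.2) (hgc x m)
    · rw [hsm hzz.1]
  have hfin : ∀ v ∈ S, v.2.1 < M := by
    intro v hv
    exact lt_of_lt_of_le ((hmemS v).1 hv) (hM v.1.1 v.1.2)
  have hcard : (Finset.univ : Finset (Fin ℓ × Fin (k / r) × Bool)).card ≤
      ((Finset.univ : Finset (Fin r)).offDiag ×ˢ (Finset.range M ×ˢ Finset.range M)).card := by
    refine Finset.card_le_card_of_injOn
      (fun z => (((P z).1.1, (P z).2.1), ((P z).1.2.1, (P z).2.2.1))) ?_ ?_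
    · intro z _
      have h1 : (P z).1.1 ≠ (P z).2.1 := (T z.1).adj_sub (hPadj z)
      simp [h1, hfin _ (hPS z).1, hfin _ (hPS z).2]
    · intro z _ z' _ hzz
      simp only [Prod.mk.injEq] at hzz
      obtain ⟨⟨h1, h2⟩, h3, h4⟩ := hzz
      have ext' : ∀ v v' : (Σ i, Fin (n i)), v.1 = v'.1 → v.2.1 = v'.2.1 → v = v' := by
        rintro ⟨i, x⟩ ⟨i', x'⟩ h h'
        simp only at h
        subst h
        exact congrArg (Sigma.mk i) (Fin.ext h')
      exact hPinj (Prod.ext (ext' _ _ h1 h3) (ext' _ _ h2 h4))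
  simpa [Finset.offDiag_card, mul_assoc] using hcard

theorem rx_general_multipartite (α : ℝ) (hα : 1 ≤ α) (C : ℝ) (hC : 0 < C)
    (k ℓ r : ℕ) (hk : 3 ≤ k) (hr : 3 ≤ r) (hℓ : 1 ≤ ℓ) :
    ∃ N : ℕ, 0 < N ∧ ∀ n : Fin r → ℕ, Monotone n → N ≤ n ⟨0, by omega⟩ →
      (n ⟨r - 1, by omega⟩ : ℝ) ≤ C * (n ⟨0, by omega⟩ : ℝ) ^ α →
      ((k < r →
        rainbowIndex (completeMultipartiteGraph (fun i : Fin r => Fin (n i))) k ℓ = k) ∧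
      ((r ≤ k ∧ (ℓ : ℚ) ≤ (r.choose 2 : ℚ) * (⌈(k : ℚ) / (r : ℚ)⌉ : ℚ) ^ 2 /
          (⌊(k : ℚ) / (r : ℚ)⌋ : ℚ)) →
        (rainbowIndex (completeMultipartiteGraph (fun i : Fin r => Fin (n i))) k ℓ = k ∨
          rainbowIndex (completeMultipartiteGraph (fun i : Fin r => Fin (n i))) k ℓ = k + 1)) ∧
      ((r ≤ k ∧ (r.choose 2 : ℚ) * (⌈(k : ℚ) / (r : ℚ)⌉ : ℚ) ^ 2 /
          (⌊(k : ℚ) / (r : ℚ)⌋ : ℚ) < (ℓ : ℚ)) →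
        rainbowIndex (completeMultipartiteGraph (fun i : Fin r => Fin (n i))) k ℓ = k + 1)) := by
  obtain ⟨N1, hN1⟩ := numeric_bound α C hα hC k ℓ r k hℓ (by omega)
  obtain ⟨N2, hN2⟩ := numeric_bound α C hα hC k ℓ r (k + 1) hℓ (by omega)
  refine ⟨N1 + N2 + k, by omega, fun n hmono hN hub => ?_⟩
  set i0 : Fin r := ⟨0, by omega⟩ with hi0
  have hle : ∀ i, n i0 ≤ n i := fun i => hmono (Fin.le_def.2 (Nat.zero_le _))
  have hle' : ∀ i, n i ≤ n ⟨r - 1, by omega⟩ := fun i =>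
    hmono (Fin.le_def.2 (by have := i.2; simp only; omega))
  have hcard : (Fintype.card (Σ i, Fin (n i)) : ℝ) ≤ r * (C * (n i0 : ℝ) ^ α) := by
    rw [Fintype.card_sigma]
    have h1 : ∑ i : Fin r, Fintype.card (Fin (n i)) ≤ r * n ⟨r - 1, by omega⟩ := by
      calc _ ≤ ∑ i : Fin r, n ⟨r - 1, by omega⟩ :=
            Finset.sum_le_sum fun i _ => by simpa using hle' i
        _ = _ := by simp
    calc ((∑ i : Fin r, Fintype.card (Fin (n i)) : ℕ) : ℝ)
        ≤ ((r * n ⟨r - 1, by omega⟩ : ℕ) : ℝ) := by exact_mod_cast h1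
      _ = r * (n ⟨r - 1, by omega⟩ : ℝ) := by push_cast; ring
      _ ≤ _ := by gcongr
  set G := completeMultipartiteGraph (fun i : Fin r => Fin (n i)) with hG
  set A : Set ℕ := {t : ℕ | ∃ c : Sym2 (Σ i, Fin (n i)) → Fin t, HasRainbowSTrees G c k ℓ} with hA
  have hidx : rainbowIndex G k ℓ = sInf A := rfl
  have hupper : k + 1 ∈ A := by
    obtain ⟨q, hq1, hq2⟩ := hN2 (n i0) _ (by omega) hcard
    exact hasRainbow_of_treeSys G k ℓ (k + 1) q (by omega)
      (fun S hS => dstar_sys n k ℓ q (fun i => hq1.trans (hle i)) hr S hS) hq2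
  have hmem : sInf A ∈ A := Nat.sInf_mem ⟨_, hupper⟩
  have hup : sInf A ≤ k + 1 := Nat.sInf_le hupper
  have hlow : k ≤ sInf A := by
    obtain ⟨c, hc⟩ := hmem
    exact lower_one n k ℓ _ hk hℓ i0 (by omega) c hc
  refine ⟨fun hkr => ?_, fun _ => ?_, fun ⟨hrk, hl⟩ => ?_⟩
  · rw [hidx]
    refine le_antisymm (Nat.sInf_le ?_) hlow
    obtain ⟨q, hq1, hq2⟩ := hN1 (n i0) _ (by omega) hcard
    exact hasRainbow_of_treeSys G k ℓ k q (by omega)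
      (fun S hS => star_sys n k ℓ q (fun i => hq1.trans (hle i)) hkr S hS) hq2
  · rw [hidx]; omega
  · rw [hidx]
    by_contra hne
    have htk : sInf A ≤ k := by omega
    obtain ⟨c, hc⟩ := hmem
    have hr0 : (0 : ℚ) < r := by exact_mod_cast (by omega : 0 < r)
    have hkr0 : (0 : ℚ) ≤ (k : ℚ) / r := by positivity
    have hd : 1 ≤ k / r := (Nat.one_le_div_iff (by omega)).2 hrk
    have hfl : ((⌊(k : ℚ) / (r : ℚ)⌋ : ℤ) : ℚ) = ((k / r : ℕ) : ℚ) := by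
      rw [Rat.floor_natCast_div_natCast]; push_cast; rfl
    have hce : ((⌈(k : ℚ) / (r : ℚ)⌉ : ℤ) : ℚ) = ((⌈(k : ℚ) / (r : ℚ)⌉₊ : ℕ) : ℚ) := by
      rw [← natCast_ceil_eq_intCast_ceil hkr0]
    rw [hfl, hce] at hl
    set M := ⌈(k : ℚ) / (r : ℚ)⌉₊ with hMdef
    have hkM : k ≤ M * r := by
      have := Nat.le_ceil ((k : ℚ) / (r : ℚ))
      rw [← hMdef, div_le_iff₀ hr0] at this
      exact_mod_cast this
    have hdm := Nat.div_add_mod k r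
    have hM : ∀ i < r, k / r + (if i < k % r then 1 else 0) ≤ M := by
      intro i _
      split_ifs with hi
      · by_contra hcon
        have h1 : M ≤ k / r := by omega
        have := Nat.mul_le_mul_right r h1
        rw [mul_comm (k / r)] at this
        omega
      · rw [add_zero]
        exact Nat.div_le_of_le_mul (by rw [mul_comm]; exact hkM)
    have key := lower_two n k ℓ _ M hk hr (fun i => by have := hle i; omega) htk c hM hc
    have hch : r * r - r = r.choose 2 * 2 := by
      rw [Nat.choose_two_right, Nat.div_mul_cancel (Nat.even_mul_pred_self r).two_dvd,
        Nat.mul_sub, mul_one]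
    rw [hch] at key
    have key2 : ℓ * (k / r) ≤ r.choose 2 * M ^ 2 := by nlinarith
    rw [div_lt_iff₀ (by exact_mod_cast hd)] at hl
    have : ((ℓ * (k / r) : ℕ) : ℚ) ≤ ((r.choose 2 * M ^ 2 : ℕ) : ℚ) := by exact_mod_cast key2
    push_cast [-Nat.cast_div] at this
    push_cast at hl
    linarith
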